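/- arXiv:2410.23416 — 3 statements merged into one kernel-verified Lean document; each statement's English description precedes it below -/
import Mathlib

section
/- For every temporal fair division instance (n agents with additive nonnegative valuations, goods M partitioned into days M_1,...,M_k), there exists an allocation A of M that is SD-EF1 per day and PROP1 overall. -/
open Finset
open scoped Classical

noncomputable section

/-- Total value of a bundle `X` under additive valuation `v`. -/
def totalVal {G : Type*} (v : G → ℝ) (X : Finset G) : ℝ := ∑ g ∈ X, v g

/-- `A` is an allocation of the set of goods `S` among `n` agents:
a partition of `S` into `n` pairwise-disjoint (possibly empty) bundles. -/
def IsAlloc {G : Type*} (n : ℕ) (S : Finset G) (A : Fin n → Finset G) : Prop :=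
  (∀ i j : Fin n, i ≠ j → Disjoint (A i) (A j)) ∧ Finset.univ.biUnion A = S

/-- The top-set `H_i(S,g) = {g' ∈ S : v g' ≥ v g}`. -/
def topSet {G : Type*} (v : G → ℝ) (S : Finset G) (g : G) : Finset G :=
  S.filter (fun g' => v g ≤ v g')

/-- Stochastic dominance: `X ≽^SD Y` w.r.t. valuation `v` over the set of goods `S`. -/
def SDge {G : Type*} [DecidableEq G] (v : G → ℝ) (S X Y : Finset G) : Prop :=
  ∀ g ∈ S, (Y ∩ topSet v S g).card ≤ (X ∩ topSet v S g).card

/-- The allocation `A` of goods `S` is SD-EF1. -/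
def SDEF1 {G : Type*} [DecidableEq G] (n : ℕ) (v : Fin n → G → ℝ) (S : Finset G)
    (A : Fin n → Finset G) : Prop :=
  ∀ i j : Fin n, A j ≠ ∅ → ∃ g ∈ A j, SDge (v i) S (A i) ((A j).erase g)

/-- The allocation `A` of goods `S` is PROP1. -/
def PROP1 {G : Type*} [DecidableEq G] (n : ℕ) (v : Fin n → G → ℝ) (S : Finset G)
    (A : Fin n → Finset G) : Prop :=
  ∀ i : Fin n, A i ≠ S → ∃ g ∈ S \ A i, totalVal (v i) S / n ≤ totalVal (v i) (insert g (A i))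

theorem pick_exists {G : Type*} [DecidableEq G] [Nonempty G] {ι : Type*} (v : ι → G → ℝ) :
    ∀ (m : ℕ) (S : Finset G) (a : ℕ → ι), S.card = m →
    ∃ b : ℕ → G, (∀ x < m, b x ∈ S) ∧ (∀ g ∈ S, ∃ x < m, b x = g) ∧
      (∀ x < m, ∀ y < m, b x = b y → x = y) ∧
      (∀ x y, x ≤ y → y < m → v (a x) (b y) ≤ v (a x) (b x)) := by
  intro m
  induction m with
  | zero =>
    intro S a hS
    obtain rfl := Finset.card_eq_zero.1 hS
    exact ⟨fun _ => Classical.arbitrary G, by simp, by simp, by simp, by simp⟩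
  | succ m ih =>
    intro S a hS
    have hne : S.Nonempty := Finset.card_pos.1 (by omega)
    obtain ⟨g, hg, hmax⟩ := Finset.exists_max_image S (v (a 0)) hne
    obtain ⟨b, h1, h2, h3, h4⟩ := ih (S.erase g) (fun x => a (x+1))
      (by rw [Finset.card_erase_of_mem hg]; omega)
    refine ⟨fun x => Nat.casesOn x g b, ?_, ?_, ?_, ?_⟩
    · rintro (_ | x) hx
      · exact hg
      · exact Finset.mem_of_mem_erase (h1 x (by omega))
    · intro g' hg'
      by_cases h : g' = g
      · exact ⟨0, by omega, h.symm⟩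
      · obtain ⟨x, hx, hb⟩ := h2 g' (Finset.mem_erase.2 ⟨h, hg'⟩)
        exact ⟨x+1, by omega, hb⟩
    · rintro (_ | x) hx (_ | y) hy h
      · rfl
      · exact absurd h.symm (Finset.ne_of_mem_erase (h1 y (by omega)))
      · exact absurd h (Finset.ne_of_mem_erase (h1 x (by omega)))
      · rw [h3 x (by omega) y (by omega) h]
    · rintro (_ | x) (_ | y) hxy hy
      · exact le_rfl
      · exact hmax _ (Finset.mem_of_mem_erase (h1 y (by omega)))
      · omega
      · exact h4 x y (by omega) (by omega)

theorem linext_exists {n : ℕ} {α : Type} [PartialOrder α] [Fintype α] (h : Fintype.card α = n) :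
    ∃ τ : α ≃ Fin n, ∀ i j : α, i < j → τ i < τ j := by
  let _ : Fintype (LinearExtension α) := inferInstanceAs (Fintype α)
  let f := Fintype.orderIsoFinOfCardEq (LinearExtension α) (k := n) h
  let g : α →o LinearExtension α := toLinearExtension
  refine ⟨f.symm.toEquiv, ?_⟩
  intro i j hij
  have h1 : g i ≤ g j := g.monotone hij.le
  have h3 : g i < g j := lt_of_le_of_ne h1 hij.ne
  exact f.symm.strictMono h3

/-- acyclic relation gives compatible permutation -/
theorem order_exists {n : ℕ} (E : Fin n → Fin n → Prop)
    (h : ∀ T : Finset (Fin n), T.Nonempty → ∃ j ∈ T, ∀ i ∈ T, ¬ E i j) :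
    ∃ τ : Equiv.Perm (Fin n), ∀ i j, E i j → τ i < τ j := by
  have hirr : ∀ a, ¬ Relation.TransGen E a a := by
    intro a ha
    obtain ⟨j, hj, hno⟩ := h (Finset.univ.filter
      (fun x => Relation.TransGen E a x ∧ Relation.TransGen E x a)) ⟨a, by simp [ha]⟩
    simp only [Finset.mem_filter, Finset.mem_univ, true_and] at hj hno
    obtain ⟨h1, h2⟩ := hj
    cases h1 with
    | single e => exact hno a ⟨ha, ha⟩ e
    | tail p e => exact hno _ ⟨p, Relation.TransGen.head e h2⟩ e
  let P : PartialOrder (Fin n) :=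
    { le := Relation.ReflTransGen E
      le_refl := fun _ => Relation.ReflTransGen.refl
      le_trans := fun _ _ _ h1 h2 => h1.trans h2
      lt := fun a b => Relation.ReflTransGen E a b ∧ ¬ Relation.ReflTransGen E b a
      lt_iff_le_not_ge := fun _ _ => Iff.rfl
      le_antisymm := by
        intro a b hab hba
        rcases Relation.reflTransGen_iff_eq_or_transGen.1 hab with h1 | h1
        · exact h1.symm
        · exact absurd (h1.trans_left hba) (hirr a) }
  obtain ⟨τ, hτ⟩ := @linext_exists n (Fin n) P _ (Fintype.card_fin n)
  refine ⟨τ, fun i j hij => hτ i j ?_⟩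
  have h2 : i ≠ j := by rintro rfl; exact hirr _ (Relation.TransGen.single hij)
  exact @lt_of_le_of_ne _ P _ _ (Relation.ReflTransGen.single hij) h2

/-- a welfare-maximal situation has no envy cycle -/
theorem cycle_perm {n : ℕ} (E : Fin n → Fin n → Prop) (T : Finset (Fin n)) (hT : T.Nonempty)
    (h : ∀ j ∈ T, ∃ i ∈ T, E i j) :
    ∃ π : Equiv.Perm (Fin n), (∀ i, π i = i ∨ E i (π i)) ∧ ∃ i, E i (π i) := by
  have hQ : ∃ m, ∃ T : Finset (Fin n), T.card = m ∧ T.Nonempty ∧ ∀ j ∈ T, ∃ i ∈ T, E i j :=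
    ⟨_, T, rfl, hT, h⟩
  obtain ⟨T, hc, hT, h⟩ := Nat.find_spec hQ
  have hmin := fun m => Nat.find_min hQ (m := m)
  choose! f hf hE using h
  have himg : T.image f = T := by
    apply Finset.eq_of_subset_of_card_le
    · intro x hx
      obtain ⟨y, hy, rfl⟩ := Finset.mem_image.1 hx
      exact hf y hy
    · by_contra hlt
      push Not at hlt
      refine hmin _ (by rw [← hc]; exact hlt) ⟨T.image f, rfl, hT.image f, ?_⟩
      intro j hj
      obtain ⟨y, hy, rfl⟩ := Finset.mem_image.1 hj
      exact ⟨f (f y), Finset.mem_image_of_mem _ (hf y hy), hE _ (hf y hy)⟩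
  let F : {x // x ∈ T} → {x // x ∈ T} := fun x => ⟨f x, hf x x.2⟩
  have hs : Function.Surjective F := by
    rintro ⟨x, hx⟩
    rw [← himg] at hx
    obtain ⟨y, hy, rfl⟩ := Finset.mem_image.1 hx
    exact ⟨⟨y, hy⟩, rfl⟩
  let e : Equiv.Perm {x // x ∈ T} := Equiv.ofBijective F (Finite.surjective_iff_bijective.1 hs)
  have key : ∀ x (hx : x ∈ T), E x ((Equiv.Perm.ofSubtype e.symm) x) := by
    intro x hx
    rw [Equiv.Perm.ofSubtype_apply_of_mem _ hx]
    have h1 : F (e.symm ⟨x, hx⟩) = ⟨x, hx⟩ := e.apply_symm_apply _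
    have h2 := hE (e.symm ⟨x, hx⟩) (e.symm ⟨x, hx⟩).2
    have h3 : f (e.symm ⟨x, hx⟩) = x := congrArg Subtype.val h1
    rwa [h3] at h2
  refine ⟨Equiv.Perm.ofSubtype e.symm, fun i => ?_, ?_⟩
  · by_cases hi : i ∈ T
    · exact Or.inr (key i hi)
    · exact Or.inl (Equiv.Perm.ofSubtype_apply_of_not_mem _ hi)
  · obtain ⟨i, hi⟩ := hT
    exact ⟨i, key i hi⟩

theorem ef1_exists {n : ℕ} {C : Type*} [DecidableEq C] (u : C → Fin n → Fin n → ℝ)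
    (h0 : ∀ c i p, 0 ≤ u c i p) (ha : ∀ c i p q, p ≤ q → u c i q ≤ u c i p) (s : Finset C) :
    ∃ σ : C → Equiv.Perm (Fin n), ∀ i j,
      (∑ c ∈ s, u c i (σ c j) ≤ ∑ c ∈ s, u c i (σ c i)) ∨
      ∃ c ∈ s, ∑ c ∈ s, u c i (σ c j) ≤ ∑ c ∈ s, u c i (σ c i) + u c i (σ c j) := by
  induction s using Finset.induction_on with
  | empty => exact ⟨fun _ => 1, by simp⟩
  | insert d s hd ih =>
    obtain ⟨σ, hσ⟩ := ih
    let good : Equiv.Perm (Fin n) → Prop := fun π => ∀ i j,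
      (∑ c ∈ s, u c i (σ c (π j)) ≤ ∑ c ∈ s, u c i (σ c (π i))) ∨
      ∃ c ∈ s, ∑ c ∈ s, u c i (σ c (π j)) ≤ ∑ c ∈ s, u c i (σ c (π i)) + u c i (σ c (π j))
    obtain ⟨π, hπ, hmax⟩ := Finset.exists_max_image (Finset.univ.filter good)
      (fun π => ∑ i, ∑ c ∈ s, u c i (σ c (π i))) ⟨1, by simpa [good] using hσ⟩
    simp only [Finset.mem_filter, Finset.mem_univ, true_and] at hπ hmax
    let E : Fin n → Fin n → Prop := fun i j =>
      ∑ c ∈ s, u c i (σ c (π i)) < ∑ c ∈ s, u c i (σ c (π j))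
    obtain ⟨τ, hτ⟩ := order_exists E (by
      intro T hT
      by_contra hno
      push Not at hno
      obtain ⟨ρ, hρ, i0, hi0⟩ := cycle_perm E T hT hno
      have hle : ∀ i, ∑ c ∈ s, u c i (σ c (π i)) ≤ ∑ c ∈ s, u c i (σ c (π (ρ i))) := by
        intro i
        rcases hρ i with h | h
        · rw [h]
        · exact h.le
      have hg : good (ρ.trans π) := by
        intro i j
        simp only [Equiv.trans_apply]
        rcases hπ i (ρ j) with h | ⟨c, hc, h⟩
        · exact Or.inl (h.trans (hle i))
        · exact Or.inr ⟨c, hc, h.trans (by linarith [hle i])⟩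
      have h1 := hmax _ hg
      have h2 : ∑ i, ∑ c ∈ s, u c i (σ c (π i)) < ∑ i, ∑ c ∈ s, u c i (σ c (π (ρ i))) :=
        Finset.sum_lt_sum (fun i _ => hle i) ⟨i0, Finset.mem_univ _, hi0⟩
      simp only [Equiv.trans_apply] at h1
      linarith)
    refine ⟨fun c => if c = d then τ else π.trans (σ c), ?_⟩
    intro i j
    have hsum : ∀ j, ∑ c ∈ s, u c i ((if c = d then τ else π.trans (σ c)) j)
        = ∑ c ∈ s, u c i (σ c (π j)) := by
      intro j
      refine Finset.sum_congr rfl fun c hc => ?_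
      rw [if_neg (by rintro rfl; exact hd hc)]; rfl
    simp only [Finset.sum_insert hd, hsum, if_true]
    by_cases hE : E i j
    · have h1 := ha d i _ _ (hτ i j hE).le
      rcases hπ i j with h | ⟨c, hc, h⟩
      · left; linarith
      · right
        refine ⟨c, Finset.mem_insert_of_mem hc, ?_⟩
        rw [if_neg (by rintro rfl; exact hd hc)]
        simp only [Equiv.trans_apply]
        linarith
    · right
      refine ⟨d, Finset.mem_insert_self _ _, ?_⟩
      simp only [E, not_lt] at hE
      have := h0 d i (τ i)
      simp only [if_true]
      linarith

/-- `b` enumerates `S`. -/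
def IsEnum {G : Type*} (S : Finset G) (b : ℕ → G) : Prop :=
  (∀ x < S.card, b x ∈ S) ∧ (∀ g ∈ S, ∃ x < S.card, b x = g) ∧
      (∀ x < S.card, ∀ y < S.card, b x = b y → x = y)

/-- the bundle of agent `j` -/
def bun {G : Type*} [DecidableEq G] {n k : ℕ} (R : ℕ) (M : Fin k → Finset G)
    (b : Fin k → ℕ → G) (σ : Fin k × ℕ → Equiv.Perm (Fin n)) (j : Fin n) : Finset G :=
  (((Finset.univ : Finset (Fin k)) ×ˢ Finset.range R).filter
    (fun c => n * c.2 + (σ c j : ℕ) < (M c.1).card)).image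
      (fun c => b c.1 (n * c.2 + (σ c j : ℕ)))

theorem pos_inj {n r r' : ℕ} {p p' : Fin n} (h : n * r + (p : ℕ) = n * r' + p') :
    r = r' ∧ p = p' := by
  have hn : 0 < n := p.pos
  have h1 : (n * r + (p : ℕ)) / n = r := by
    rw [Nat.mul_add_div hn, Nat.div_eq_of_lt p.2, add_zero]
  have h2 : (n * r' + (p' : ℕ)) / n = r' := by
    rw [Nat.mul_add_div hn, Nat.div_eq_of_lt p'.2, add_zero]
  have h3 : r = r' := by rw [← h1, ← h2, h]
  subst h3
  exact ⟨rfl, Fin.ext (by omega)⟩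

section
variable {G : Type*} [DecidableEq G] {n k : ℕ} {R : ℕ} {M : Fin k → Finset G}
    {b : Fin k → ℕ → G} {σ : Fin k × ℕ → Equiv.Perm (Fin n)}

theorem mem_bun {j : Fin n} {g : G} : g ∈ bun R M b σ j ↔
    ∃ t r, r < R ∧ n * r + (σ (t, r) j : ℕ) < (M t).card ∧ b t (n * r + (σ (t, r) j : ℕ)) = g := by
  unfold bun
  simp only [Finset.mem_image, Finset.mem_filter, Finset.mem_product, Finset.mem_univ,
    Finset.mem_range, true_and, Prod.exists, and_assoc]

theorem slot_inj (hdisj : ∀ t t' : Fin k, t ≠ t' → Disjoint (M t) (M t'))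
    (hb : ∀ t, IsEnum (M t) (b t)) {t t' : Fin k} {r r' : ℕ} {p p' : Fin n}
    (h1 : n * r + (p : ℕ) < (M t).card) (h2 : n * r' + (p' : ℕ) < (M t').card)
    (h : b t (n * r + (p : ℕ)) = b t' (n * r' + (p' : ℕ))) : t = t' ∧ r = r' ∧ p = p' := by
  have ht : t = t' := by
    by_contra hne
    exact Finset.disjoint_left.1 (hdisj t t' hne) ((hb t).1 _ h1) (h ▸ (hb t').1 _ h2)
  subst ht
  exact ⟨rfl, pos_inj ((hb t).2.2 _ h1 _ h2 h)⟩

theorem bun_disj (hdisj : ∀ t t' : Fin k, t ≠ t' → Disjoint (M t) (M t'))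
    (hb : ∀ t, IsEnum (M t) (b t)) (i j : Fin n) (hij : i ≠ j) :
    Disjoint (bun R M b σ i) (bun R M b σ j) := by
  rw [Finset.disjoint_left]
  intro g h1 h2
  obtain ⟨t, r, hr, hx, rfl⟩ := mem_bun.1 h1
  obtain ⟨t', r', hr', hx', h⟩ := mem_bun.1 h2
  obtain ⟨rfl, rfl, hp⟩ := slot_inj hdisj hb hx' hx h
  exact hij ((σ _).injective hp).symm

theorem bun_alloc (hn : 0 < n) (hdisj : ∀ t t' : Fin k, t ≠ t' → Disjoint (M t) (M t'))
    (hb : ∀ t, IsEnum (M t) (b t)) (hR : ∀ t, (M t).card ≤ R) :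
    IsAlloc n (Finset.univ.biUnion M) (bun R M b σ) := by
  refine ⟨bun_disj hdisj hb, ?_⟩
  ext g
  simp only [Finset.mem_biUnion, Finset.mem_univ, true_and]
  constructor
  · rintro ⟨j, hj⟩
    obtain ⟨t, r, hr, hx, rfl⟩ := mem_bun.1 hj
    exact ⟨t, (hb t).1 _ hx⟩
  · rintro ⟨t, ht⟩
    obtain ⟨x, hx, rfl⟩ := (hb t).2.1 g ht
    refine ⟨(σ (t, x / n)).symm ⟨x % n, Nat.mod_lt _ hn⟩, mem_bun.2 ⟨t, x / n, ?_, ?_, ?_⟩⟩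
    · exact (Nat.div_le_self _ _).trans_lt (hx.trans_le (hR t))
    · simp only [Equiv.apply_symm_apply, Nat.div_add_mod]; exact hx
    · simp only [Equiv.apply_symm_apply, Nat.div_add_mod]

theorem bun_cover (hn : 0 < n) (hdisj : ∀ t t' : Fin k, t ≠ t' → Disjoint (M t) (M t'))
    (hb : ∀ t, IsEnum (M t) (b t)) (hR : ∀ t, (M t).card ≤ R) :
    Finset.univ.biUnion (bun R M b σ) = Finset.univ.biUnion M := by
  have h := (bun_alloc (σ := σ) hn hdisj hb hR).2
  ext g
  rw [← h]
  simp only [Finset.mem_biUnion]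

theorem bun_sum (hdisj : ∀ t t' : Fin k, t ≠ t' → Disjoint (M t) (M t'))
    (hb : ∀ t, IsEnum (M t) (b t)) (j : Fin n) (f : G → ℝ) :
    ∑ g ∈ bun R M b σ j, f g = ∑ c ∈ (Finset.univ : Finset (Fin k)) ×ˢ Finset.range R,
      if n * c.2 + (σ c j : ℕ) < (M c.1).card then f (b c.1 (n * c.2 + (σ c j : ℕ))) else 0 := by
  unfold bun
  rw [Finset.sum_image, Finset.sum_filter]
  rintro ⟨t, r⟩ h1 ⟨t', r'⟩ h2 h
  simp only [Finset.coe_filter, Set.mem_ofPred_eq] at h1 h2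
  obtain ⟨rfl, rfl, -⟩ := slot_inj hdisj hb h1.2 h2.2 h
  rfl

theorem bun_inter (hdisj : ∀ t t' : Fin k, t ≠ t' → Disjoint (M t) (M t'))
    (hb : ∀ t, IsEnum (M t) (b t)) {j : Fin n} {t : Fin k} {g : G} :
    g ∈ bun R M b σ j ∩ M t ↔ ∃ r, r < R ∧ n * r + (σ (t, r) j : ℕ) < (M t).card ∧
      b t (n * r + (σ (t, r) j : ℕ)) = g := by
  rw [Finset.mem_inter, mem_bun]
  constructor
  · rintro ⟨⟨t', r, hr, hx, rfl⟩, hg⟩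
    have : t' = t := by
      by_contra hne
      exact Finset.disjoint_left.1 (hdisj t' t hne) ((hb t').1 _ hx) hg
    subst this
    exact ⟨r, hr, hx, rfl⟩
  · rintro ⟨r, hr, hx, rfl⟩
    exact ⟨⟨t, r, hr, hx, rfl⟩, (hb t).1 _ hx⟩

theorem bun_sdef1 (v : Fin n → G → ℝ)
    (hdisj : ∀ t t' : Fin k, t ≠ t' → Disjoint (M t) (M t'))
    (hb : ∀ t, IsEnum (M t) (b t))
    (hgr : ∀ t r i y, n * r + (σ (t, r) i : ℕ) ≤ y → y < (M t).card →
      v i (b t y) ≤ v i (b t (n * r + (σ (t, r) i : ℕ)))) (t : Fin k) :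
    SDEF1 n v (M t) (fun i => bun R M b σ i ∩ M t) := by
  intro i j hne
  obtain ⟨g, hg⟩ := Finset.nonempty_iff_ne_empty.2 hne
  obtain ⟨r, hr, hx, rfl⟩ := (bun_inter hdisj hb).1 hg
  have hlt : ∀ r (p q : Fin n), n * r + (p : ℕ) < n * (r + 1) + q := by
    intro r p q
    have := p.2
    rw [Nat.mul_add]; omega
  have h0 : n * 0 + (σ (t, 0) j : ℕ) < (M t).card := by
    rcases r with _ | r
    · exact hx
    · refine lt_of_le_of_lt ?_ hx
      have := (σ (t, 0) j).2
      rw [Nat.mul_add]; omega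
  refine ⟨b t (n * 0 + (σ (t, 0) j : ℕ)),
    (bun_inter hdisj hb).2 ⟨0, by omega, h0, rfl⟩, ?_⟩
  intro g0 hg0
  -- map each good of `j` to the good of `i` one round earlier
  have hex : ∀ g ∈ (((bun R M b σ j ∩ M t).erase (b t (n * 0 + (σ (t, 0) j : ℕ)))) ∩
      topSet (v i) (M t) g0), ∃ r, r + 1 < R ∧ n * (r + 1) + (σ (t, r + 1) j : ℕ) < (M t).card ∧
      b t (n * (r + 1) + (σ (t, r + 1) j : ℕ)) = g := by
    intro g hg
    obtain ⟨h1, -⟩ := Finset.mem_inter.1 hg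
    obtain ⟨h2, h3⟩ := Finset.mem_erase.1 h1
    obtain ⟨r, hr, hx, rfl⟩ := (bun_inter hdisj hb).1 h3
    rcases r with _ | r
    · exact absurd rfl h2
    · exact ⟨r, hr, hx, rfl⟩
  choose! ρ hρ1 hρ2 hρ3 using hex
  refine Finset.card_le_card_of_injOn (fun g => b t (n * ρ g + (σ (t, ρ g) i : ℕ))) ?_ ?_
  · intro g hg
    have hg' := hg
    simp only [Finset.mem_coe] at hg hg' ⊢
    have h1 := hρ2 g hg
    have h2 := hlt (ρ g) (σ (t, ρ g) i) (σ (t, ρ g + 1) j)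
    have h3 := hgr t (ρ g) i _ h2.le h1
    rw [hρ3 g hg] at h3
    refine Finset.mem_inter.2 ⟨(bun_inter hdisj hb).2
      ⟨ρ g, by have := hρ1 g hg; omega, by omega, rfl⟩, ?_⟩
    have h4 := (Finset.mem_inter.1 hg).2
    unfold topSet at h4 ⊢
    rw [Finset.mem_filter] at h4 ⊢
    exact ⟨(hb t).1 _ (by omega), h4.2.trans h3⟩
  · intro g hg g' hg' h
    simp only [Finset.mem_coe] at hg hg'
    have h1 := hρ2 g hg
    have h2 := hlt (ρ g) (σ (t, ρ g) i) (σ (t, ρ g + 1) j)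
    have h1' := hρ2 g' hg'
    have h2' := hlt (ρ g') (σ (t, ρ g') i) (σ (t, ρ g' + 1) j)
    obtain ⟨-, h5, -⟩ := slot_inj hdisj hb (by omega) (by omega) h
    rw [← hρ3 g hg, ← hρ3 g' hg', h5]

end

theorem pick_ge {G : Type*} [DecidableEq G] {S : Finset G} {b e : ℕ → G} (w : G → ℝ)
    (hb : IsEnum S b) (he : IsEnum S e)
    (hem : ∀ x y, x ≤ y → y < S.card → w (e y) ≤ w (e x)) (x : ℕ) (hx : x < S.card)
    (hbm : ∀ y, x ≤ y → y < S.card → w (b y) ≤ w (b x)) : w (e x) ≤ w (b x) := by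
  have : ∃ z ≤ x, ∃ y, x ≤ y ∧ y < S.card ∧ b y = e z := by
    by_contra hno
    push Not at hno
    have hsub : (Finset.range (x + 1)).image e ⊆ (Finset.range x).image b := by
      intro g hg
      obtain ⟨z, hz, rfl⟩ := Finset.mem_image.1 hg
      rw [Finset.mem_range] at hz
      obtain ⟨y, hy, hby⟩ := hb.2.1 _ (he.1 z (by omega))
      refine Finset.mem_image.2 ⟨y, Finset.mem_range.2 ?_, hby⟩
      by_contra hxy
      exact hno z (by omega) y (by omega) hy hby
    have h1 := Finset.card_le_card hsub
    rw [Finset.card_image_of_injOn] at h1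
    · have h2 := Finset.card_image_le (s := Finset.range x) (f := b)
      simp only [Finset.card_range] at h1 h2
      omega
    · intro p hp q hq h
      simp only [Finset.coe_range, Set.mem_Iio] at hp hq
      exact he.2.2 p (by omega) q (by omega) h
  obtain ⟨z, hz, y, hxy, hy, h⟩ := this
  calc w (e x) ≤ w (e z) := hem z x hz hx
    _ = w (b y) := by rw [h]
    _ ≤ w (b x) := hbm y hxy hy

/-- transfer from the ordered instance -/
theorem transfer {G : Type*} [DecidableEq G] (w : G → ℝ) (S A X : Finset G) (g ρ : G)
    (hmax : ∀ x ∈ S \ A, w x ≤ w g) (hXS : X ⊆ S) (hρ : ρ ∈ S) (hρX : ρ ∉ X)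
    (hmin : ∑ x ∈ X, min (w x) (w g) ≤ ∑ x ∈ A, min (w x) (w g)) :
    ∑ x ∈ X, w x + w ρ ≤ ∑ x ∈ A, w x + w g := by
  have hsplit : ∀ Y : Finset G, ∑ x ∈ Y, w x =
      ∑ x ∈ Y, max (w x - w g) 0 + ∑ x ∈ Y, min (w x) (w g) := by
    intro Y
    rw [← Finset.sum_add_distrib]
    refine Finset.sum_congr rfl fun x _ => ?_
    rcases le_total (w x) (w g) with h | h
    · rw [max_eq_right (by linarith), min_eq_left h]; ring
    · rw [max_eq_left (by linarith), min_eq_right h]; ring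
  have h1 : ∑ x ∈ insert ρ X, max (w x - w g) 0 ≤ ∑ x ∈ A, max (w x - w g) 0 := by
    rw [← Finset.sum_filter_ne_zero]
    refine Finset.sum_le_sum_of_subset_of_nonneg ?_ (fun _ _ _ => le_max_right _ _)
    intro x hx
    obtain ⟨hx1, hx2⟩ := Finset.mem_filter.1 hx
    have hxS : x ∈ S := by
      rcases Finset.mem_insert.1 hx1 with rfl | h
      · exact hρ
      · exact hXS h
    by_contra hxA
    exact hx2 (max_eq_right (by linarith [hmax x (Finset.mem_sdiff.2 ⟨hxS, hxA⟩)]))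
  have h2 := hsplit (insert ρ X)
  rw [Finset.sum_insert hρX, Finset.sum_insert hρX (f := fun x => min (w x) (w g))] at h2
  have h3 := min_le_right (w ρ) (w g)
  have h4 := hsplit A
  linarith

/-- For every temporal fair division instance (n agents with additive
nonnegative valuations, goods partitioned into days `M 0, …, M (k-1)`), there exists an
allocation of all the goods that is SD-EF1 per day and PROP1 overall. -/
theorem exists_sdef1_perDay_prop1_overall
    {G : Type*} [DecidableEq G] (n k : ℕ) (hn : 0 < n)
    (M : Fin k → Finset G)
    (hdisj : ∀ t t' : Fin k, t ≠ t' → Disjoint (M t) (M t'))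
    (v : Fin n → G → ℝ)
    (hv : ∀ i : Fin n, ∀ g ∈ Finset.univ.biUnion M, 0 ≤ v i g) :
    ∃ A : Fin n → Finset G,
      IsAlloc n (Finset.univ.biUnion M) A ∧
      (∀ t : Fin k, SDEF1 n v (M t) (fun i => A i ∩ M t)) ∧
      PROP1 n v (Finset.univ.biUnion M) A := by
  rcases isEmpty_or_nonempty G with hG | hG
  · refine ⟨fun _ => ∅, ⟨by simp, ?_⟩, ?_, ?_⟩
    · ext g; exact hG.elim g
    · intro t i j h
      exact absurd (by ext g; exact hG.elim g) h
    · intro i h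
      exact absurd (by ext g; exact hG.elim g) h
  set S := Finset.univ.biUnion M with hS
  have hMS : ∀ t, M t ⊆ S := fun t => Finset.subset_biUnion_of_mem M (Finset.mem_univ t)
  have hR : ∀ t, (M t).card ≤ S.card := fun t => Finset.card_le_card (hMS t)
  have he : ∀ i t, ∃ e : ℕ → G, IsEnum (M t) e ∧
      ∀ x y, x ≤ y → y < (M t).card → v i (e y) ≤ v i (e x) := by
    intro i t
    obtain ⟨e, h1, h2, h3, h4⟩ := pick_exists v _ (M t) (fun _ => i) rfl
    exact ⟨e, ⟨h1, h2, h3⟩, h4⟩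
  choose e he hem using he
  let u : Fin k × ℕ → Fin n → Fin n → ℝ := fun c i p =>
    if n * c.2 + (p : ℕ) < (M c.1).card then v i (e i c.1 (n * c.2 + (p : ℕ))) else 0
  have hpos : ∀ i t x, x < (M t).card → 0 ≤ v i (e i t x) := fun i t x hx =>
    hv i _ (hMS t ((he i t).1 x hx))
  obtain ⟨σ, hσ⟩ := ef1_exists u
    (by
      intro c i p
      simp only [u]
      split_ifs with h
      · exact hpos _ _ _ h
      · exact le_rfl)
    (by
      intro c i p q hpq
      have hpq' : (p : ℕ) ≤ q := hpq
      simp only [u]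
      split_ifs with h h' h'
      · exact hem _ _ _ _ (by omega) h
      · omega
      · exact hpos _ _ _ h'
      · exact le_rfl)
    ((Finset.univ : Finset (Fin k)) ×ˢ Finset.range S.card)
  have hb : ∀ t, ∃ b : ℕ → G, IsEnum (M t) b ∧ ∀ r i y, n * r + (σ (t, r) i : ℕ) ≤ y →
      y < (M t).card → v i (b y) ≤ v i (b (n * r + (σ (t, r) i : ℕ))) := by
    intro t
    obtain ⟨b, h1, h2, h3, h4⟩ := pick_exists v _ (M t)
      (fun x => (σ (t, x / n)).symm ⟨x % n, Nat.mod_lt _ hn⟩) rfl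
    refine ⟨b, ⟨h1, h2, h3⟩, ?_⟩
    intro r i y hy hyc
    have h5 := h4 _ y hy hyc
    have h6 : (n * r + (σ (t, r) i : ℕ)) / n = r := by
      rw [Nat.mul_add_div hn, Nat.div_eq_of_lt (σ (t, r) i).2, add_zero]
    have h7 : (n * r + (σ (t, r) i : ℕ)) % n = (σ (t, r) i : ℕ) := by
      rw [Nat.mul_add_mod, Nat.mod_eq_of_lt (σ (t, r) i).2]
    simpa only [h6, h7, Fin.eta, Equiv.symm_apply_apply] using h5
  choose b hb hgr using hb
  have halloc := bun_alloc (R := S.card) (σ := σ) hn hdisj hb hR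
  refine ⟨bun S.card M b σ, halloc, ?_, ?_⟩
  · intro t
    have := bun_sdef1 (R := S.card) (σ := σ) v hdisj hb hgr t
    convert this
  · intro i hAi
    have hAS : bun S.card M b σ i ⊆ S := by
      have hX := bun_cover (R := S.card) (σ := σ) hn hdisj (hb) hR
      rw [← hS] at hX
      exact (Finset.subset_biUnion_of_mem _ (Finset.mem_univ i)).trans hX.subset
    have hne : (S \ bun S.card M b σ i).Nonempty := by
      rw [Finset.sdiff_nonempty]
      exact fun h => hAi (Finset.Subset.antisymm hAS h)
    obtain ⟨g, hg, hmax⟩ := Finset.exists_max_image _ (v i) hne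
    refine ⟨g, hg, ?_⟩
    obtain ⟨hgS, hgA⟩ := Finset.mem_sdiff.1 hg
    have hg0 : 0 ≤ v i g := hv i g hgS
    have halloc' := bun_alloc (R := S.card) (σ := σ) hn hdisj (he i) hR
    have hXS : ∀ j, bun S.card M (e i) σ j ⊆ S := by
      intro j
      have hX := bun_cover (R := S.card) (σ := σ) hn hdisj (he i) hR
      rw [← hS] at hX
      exact (Finset.subset_biUnion_of_mem _ (Finset.mem_univ j)).trans hX.subset
    have hmono : ∀ f : ℝ → ℝ, Monotone f →
        ∑ x ∈ bun S.card M (e i) σ i, f (v i x) ≤ ∑ x ∈ bun S.card M b σ i, f (v i x) := by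
      intro f hf
      rw [bun_sum hdisj (he i) i (fun x => f (v i x)), bun_sum hdisj hb i (fun x => f (v i x))]
      refine Finset.sum_le_sum fun c _ => ?_
      split_ifs with h
      · exact hf (pick_ge (v i) (hb c.1) (he i c.1) (hem i c.1) _ h
          (fun y hy hyc => hgr c.1 c.2 i y hy hyc))
      · exact le_rfl
    have hV : ∀ j, ∑ x ∈ bun S.card M (e i) σ j, v i x =
        ∑ c ∈ (Finset.univ : Finset (Fin k)) ×ˢ Finset.range S.card, u c i (σ c j) :=
      fun j => bun_sum hdisj (he i) j (v i)
    have hii := hmono id monotone_id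
    simp only [id] at hii
    have key : ∀ j, ∑ x ∈ bun S.card M (e i) σ j, v i x ≤
        ∑ x ∈ bun S.card M b σ i, v i x + v i g := by
      intro j
      by_cases hij : j = i
      · subst hij; linarith
      rcases hσ i j with h | ⟨c, hc, h⟩
      · rw [← hV, ← hV] at h; linarith
      · rw [← hV, ← hV] at h
        by_cases hval : n * c.2 + (σ c j : ℕ) < (M c.1).card
        · simp only [u, if_pos hval] at h
          have hmem : e i c.1 (n * c.2 + (σ c j : ℕ)) ∈ bun S.card M (e i) σ j :=
            mem_bun.2 ⟨c.1, c.2, by simpa using hc, hval, rfl⟩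
          have := transfer (v i) S (bun S.card M b σ i) (bun S.card M (e i) σ i) g _ hmax (hXS i)
            (hXS j hmem) (Finset.disjoint_left.1 (halloc'.1 j i hij) hmem)
            (hmono (fun x => min x (v i g)) (fun _ _ h => min_le_min_right _ h))
          linarith
        · simp only [u, if_neg hval] at h
          linarith
    have htot : totalVal (v i) S = ∑ j, ∑ x ∈ bun S.card M (e i) σ j, v i x := by
      have hX := bun_cover (R := S.card) (σ := σ) hn hdisj (he i) hR
      rw [← hS] at hX
      have h1 : ∑ x ∈ Finset.univ.biUnion (bun S.card M (e i) σ), v i x =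
          ∑ j, ∑ x ∈ bun S.card M (e i) σ j, v i x :=
        Finset.sum_biUnion (fun a _ c _ hac => halloc'.1 a c hac)
      rw [← h1]
      unfold totalVal
      exact (congrArg (fun Y => ∑ x ∈ Y, v i x) hX).symm
    have hn' : (0 : ℝ) < n := by exact_mod_cast hn
    rw [div_le_iff₀ hn', htot]
    unfold totalVal
    rw [Finset.sum_insert hgA]
    calc _ ≤ ∑ _j : Fin n, (∑ x ∈ bun S.card M b σ i, v i x + v i g) :=
          Finset.sum_le_sum fun j _ => key j
      _ = _ := by
          rw [Finset.sum_const, Finset.card_univ, Fintype.card_fin, nsmul_eq_mul]; ring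
end
end

section
/- For every temporal fair division instance with n = 2 agents, there exists an allocation A of M that is SD-EF1 per day and EF1 up to each day. -/
open Finset
open scoped Classical

noncomputable section

/-- The allocation `A` is EF1 (envy-free up to one good). -/
def EF1 {G : Type*} [DecidableEq G] (n : ℕ) (v : Fin n → G → ℝ)
    (A : Fin n → Finset G) : Prop :=
  ∀ i j : Fin n, A j ≠ ∅ → ∃ g ∈ A j, totalVal (v i) ((A j).erase g) ≤ totalVal (v i) (A i)

/-- The union of the goods of the first days, up to and including day `t`. -/
def upTo {G : Type*} [DecidableEq G] {k : ℕ} (M : Fin k → Finset G) (t : Fin k) : Finset G :=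
  (Finset.Iic t).biUnion M

/-- Balanced pair of bundles. -/
def Bal {G : Type*} (v : G → ℝ) (X Y : Finset G) : Prop :=
  ∀ c : ℝ, (X.filter (fun g => c ≤ v g)).card ≤ (Y.filter (fun g => c ≤ v g)).card + 1

theorem two_color {G : Type*} [DecidableEq G] : ∀ (n : ℕ) (S : Finset G), S.card = n →
    ∀ R1 R2 : G → G → Prop,
    (∀ a b, R1 a b → R1 b a) → (∀ a, ¬ R1 a a) → (∀ a b c, R1 a b → R1 a c → b = c) →
    (∀ a b, R2 a b → R2 b a) → (∀ a, ¬ R2 a a) → (∀ a b c, R2 a b → R2 a c → b = c) →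
    ∃ col : G → Bool, ∀ a ∈ S, ∀ b ∈ S, (R1 a b ∨ R2 a b) → col a ≠ col b := by
  intro n
  induction n using Nat.strong_induction_on with
  | _ n ih =>
  intro S hS
  have key : ∀ R1 R2 : G → G → Prop,
    (∀ a b, R1 a b → R1 b a) → (∀ a, ¬ R1 a a) → (∀ a b c, R1 a b → R1 a c → b = c) →
    (∀ a b, R2 a b → R2 b a) → (∀ a, ¬ R2 a a) → (∀ a b c, R2 a b → R2 a c → b = c) →
    (∃ x ∈ S, ∃ y ∈ S, R1 x y) →
    ∃ col : G → Bool, ∀ a ∈ S, ∀ b ∈ S, (R1 a b ∨ R2 a b) → col a ≠ col b := by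
    rintro R1 R2 s1 i1 f1 s2 i2 f2 ⟨x, hx, y, hy, hxy⟩
    have hne : x ≠ y := by rintro rfl; exact i1 _ hxy
    have hlt : ((S.erase x).erase y).card < n := by
      have h1 : y ∈ S.erase x := by simp [hne.symm, hy]
      have := Finset.card_erase_lt_of_mem h1
      have := Finset.card_erase_lt_of_mem hx
      omega
    obtain ⟨col, hcol⟩ := ih _ hlt ((S.erase x).erase y) rfl R1
      (fun a b => (a ≠ x ∧ a ≠ y ∧ b ≠ x ∧ b ≠ y) ∧
        (R2 a b ∨ (R2 a x ∧ R2 y b) ∨ (R2 a y ∧ R2 x b))) s1 i1 f1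
      (by grind) (by grind) (by grind)
    have hd : ∃ d : Bool, (∀ x' ∈ (S.erase x).erase y, R2 x x' → d ≠ col x') ∧
        (∀ y' ∈ (S.erase x).erase y, R2 y y' → d = col y') := by
      by_cases h1 : ∃ y' ∈ (S.erase x).erase y, R2 y y'
      · obtain ⟨y', hy', h⟩ := h1
        refine ⟨col y', ?_, ?_⟩
        · intro x' hx' hR
          refine hcol y' hy' x' hx' (Or.inr ⟨?_, ?_⟩)
          · simp only [Finset.mem_erase] at hx' hy'; tauto
          · exact Or.inr (Or.inr ⟨s2 _ _ h, hR⟩)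
        · intro y'' _ hR
          rw [f2 _ _ _ h hR]
      · by_cases h2 : ∃ x' ∈ (S.erase x).erase y, R2 x x'
        · obtain ⟨x', hx', h⟩ := h2
          refine ⟨!col x', ?_, ?_⟩
          · intro x'' _ hR
            rw [f2 _ _ _ h hR]; simp
          · intro y' hy' hR; exact absurd ⟨y', hy', hR⟩ h1
        · refine ⟨true, ?_, ?_⟩
          · intro x' hx' hR; exact absurd ⟨x', hx', hR⟩ h2
          · intro y' hy' hR; exact absurd ⟨y', hy', hR⟩ h1
    obtain ⟨d, hd1, hd2⟩ := hd
    refine ⟨fun z => if z = x then d else if z = y then !d else col z, ?_⟩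
    intro a ha b hb hab
    simp only [Finset.mem_erase] at hcol hd1 hd2
    have e1 : ∀ z, R1 x z → z = y := fun z h => (f1 _ _ _ h hxy)
    have e2 : ∀ z, R1 y z → z = x := fun z h => (f1 _ _ _ h (s1 _ _ hxy))
    by_cases hax : a = x
    · by_cases hbx : b = x
      · grind
      · by_cases hby : b = y
        · grind
        · have := hd1 b; grind
    · by_cases hay : a = y
      · by_cases hbx : b = x
        · grind
        · by_cases hby : b = y
          · grind
          · have := hd2 b; grind
      · by_cases hbx : b = x
        · have := hd1 a; grind
        · by_cases hby : b = y
          · have := hd2 a; grind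
          · have := hcol a ⟨hay, hax, ha⟩ b ⟨hby, hbx, hb⟩
            grind
  intro R1 R2 s1 i1 f1 s2 i2 f2
  by_cases h1 : ∃ x ∈ S, ∃ y ∈ S, R1 x y
  · exact key R1 R2 s1 i1 f1 s2 i2 f2 h1
  by_cases h2 : ∃ x ∈ S, ∃ y ∈ S, R2 x y
  · obtain ⟨col, h⟩ := key R2 R1 s2 i2 f2 s1 i1 f1 h2
    exact ⟨col, fun a ha b hb hab => h a ha b hb hab.symm⟩
  · refine ⟨fun _ => true, fun a ha b hb hab => ?_⟩
    rcases hab with h | h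
    · exact absurd ⟨a, ha, b, hb, h⟩ h1
    · exact absurd ⟨a, ha, b, hb, h⟩ h2

theorem matching_exists {G : Type*} [DecidableEq G] (v : G → ℝ) : ∀ (n : ℕ) (S : Finset G),
    S.card = n → ∃ R : G → G → Prop, (∀ a b, R a b → a ∈ S ∧ b ∈ S) ∧
    (∀ a b, R a b → R b a) ∧ (∀ a, ¬ R a a) ∧ (∀ a b c, R a b → R a c → b = c) ∧
    ∀ col : G → Bool, (∀ a ∈ S, ∀ b ∈ S, R a b → col a ≠ col b) → ∀ d : Bool,
      Bal v (S.filter (fun g => col g = d)) (S.filter (fun g => col g = !d)) := by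
  intro n
  induction n using Nat.strong_induction_on with
  | _ n ih =>
  intro S hS
  by_cases h1 : S.card ≤ 1
  · refine ⟨fun _ _ => False, by simp, by simp, by simp, by simp, ?_⟩
    intro col _ d c
    refine le_trans (le_trans (Finset.card_filter_le _ _) (Finset.card_filter_le _ _)) (by omega)
  push Not at h1
  have hne : S.Nonempty := Finset.card_pos.mp (by omega)
  obtain ⟨x, hx, hxm⟩ := S.exists_max_image v hne
  have hc1 := Finset.card_erase_of_mem hx
  obtain ⟨y, hy, hym⟩ := (S.erase x).exists_max_image v (Finset.card_pos.mp (by omega))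
  have hc2 := Finset.card_erase_of_mem hy
  obtain ⟨T, hT⟩ : ∃ T, T = (S.erase x).erase y := ⟨_, rfl⟩
  have hyT : y ∉ T := by simp [hT]
  have hxT : x ∉ T := by simp [hT]
  have hxy : y ≠ x := (Finset.mem_erase.mp hy).1
  have hST : S = insert x (insert y T) := by
    rw [hT, Finset.insert_erase hy, Finset.insert_erase hx]
  obtain ⟨R, rs, rsym, rirr, rf, rb⟩ := ih T.card (by rw [hT]; omega) T rfl
  refine ⟨fun a b => (a = x ∧ b = y) ∨ (a = y ∧ b = x) ∨ R a b, ?_, ?_, ?_, ?_, ?_⟩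
  · intro a b h; rw [hST]; simp only [Finset.mem_insert]; grind
  · grind
  · grind
  · grind
  · intro col hcol d c
    have hcxy : col x ≠ col y := hcol x hx y (Finset.mem_of_mem_erase hy) (Or.inl ⟨rfl, rfl⟩)
    have hb := rb col (fun a ha b hb h => hcol a (by rw [hST]; simp [ha]) b (by rw [hST]; simp [hb])
      (Or.inr (Or.inr h))) d c
    by_cases hcy : c ≤ v y
    · have hcx : c ≤ v x := hcy.trans (hxm y (Finset.mem_of_mem_erase hy))
      rw [hST]
      simp only [Finset.filter_filter] at hb ⊢
      rw [Finset.filter_insert, Finset.filter_insert, Finset.filter_insert, Finset.filter_insert]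
      simp only [hcy, hcx, and_true]
      rcases Bool.eq_or_eq_not (col x) d with h | h
      · have h' : col y = !d := by revert hcxy; rw [h]; cases d <;> cases col y <;> simp
        simp only [h, h']
        cases d <;> simp [hyT, hxT] <;> simpa using hb
      · have h' : col y = d := by revert hcxy; rw [h]; cases d <;> cases col y <;> simp
        simp only [h, h']
        cases d <;> simp [hyT, hxT] <;> simpa using hb
    · have : ((S.filter (fun g => col g = d)).filter (fun g => c ≤ v g)) ⊆ {x} := by
        intro z hz
        simp only [Finset.mem_filter] at hz
        by_contra hzx
        rw [Finset.mem_singleton] at hzx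
        exact hcy (hz.2.trans (hym z (Finset.mem_erase.mpr ⟨hzx, hz.1.1⟩)))
      have := Finset.card_le_card this
      simp at this
      omega

theorem day_split {G : Type*} [DecidableEq G] (v : Fin 2 → G → ℝ) (S : Finset G) :
    ∃ X Y : Finset G, Disjoint X Y ∧ X ∪ Y = S ∧ ∀ i, Bal (v i) X Y ∧ Bal (v i) Y X := by
  obtain ⟨R1, -, s1, i1, f1, b1⟩ := matching_exists (v 0) _ S rfl
  obtain ⟨R2, -, s2, i2, f2, b2⟩ := matching_exists (v 1) _ S rfl
  obtain ⟨col, hcol⟩ := two_color _ S rfl R1 R2 s1 i1 f1 s2 i2 f2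
  have c1 := b1 col (fun a ha b hb h => hcol a ha b hb (Or.inl h))
  have c2 := b2 col (fun a ha b hb h => hcol a ha b hb (Or.inr h))
  refine ⟨S.filter (fun g => col g = true), S.filter (fun g => col g = false), ?_, ?_, ?_⟩
  · rw [Finset.disjoint_left]; intro a; simp; intro _ h; simp [h]
  · ext a; simp only [Finset.mem_union, Finset.mem_filter]; cases col a <;> simp
  · intro i
    fin_cases i
    · exact ⟨c1 true, c1 false⟩
    · exact ⟨c2 true, c2 false⟩

theorem sd_sum {G : Type*} [DecidableEq G] (v : G → ℝ) : ∀ (n : ℕ) (Z X : Finset G), Z.card = n →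
    (∀ g ∈ X, 0 ≤ v g) →
    (∀ c : ℝ, (Z.filter (fun g => c ≤ v g)).card ≤ (X.filter (fun g => c ≤ v g)).card) →
    totalVal v Z ≤ totalVal v X := by
  intro n
  induction n with
  | zero =>
    intro Z X hZ hX _
    rw [Finset.card_eq_zero] at hZ
    subst hZ
    simpa [totalVal] using Finset.sum_nonneg hX
  | succ n ih =>
    intro Z X hZ hX h
    obtain ⟨z, hz, hzm⟩ := Z.exists_max_image v (Finset.card_pos.mp (by omega))
    have h0 : 0 < (Z.filter (fun g => v z ≤ v g)).card :=
      Finset.card_pos.mpr ⟨z, by simp [hz]⟩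
    have h1 := lt_of_lt_of_le h0 (h (v z))
    obtain ⟨x, hx⟩ := Finset.card_pos.mp h1
    rw [Finset.mem_filter] at hx
    have := ih (Z.erase z) (X.erase x) (by rw [Finset.card_erase_of_mem hz]; omega)
      (fun g hg => hX g (Finset.mem_of_mem_erase hg)) (by
        intro c
        rw [Finset.filter_erase, Finset.filter_erase]
        by_cases hc : c ≤ v z
        · rw [Finset.card_erase_of_mem (by simp [hz, hc]),
            Finset.card_erase_of_mem (by simp [hx.1, hc.trans hx.2])]
          have := h c
          omega
        · have : (Z.filter (fun g => c ≤ v g)) = ∅ := by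
            rw [Finset.filter_eq_empty_iff]
            intro g hg hcg
            exact hc (hcg.trans (hzm g hg))
          simp [this])
    unfold totalVal at *
    rw [← Finset.add_sum_erase _ _ hz, ← Finset.add_sum_erase _ _ hx.1]
    linarith [hx.2]

theorem bal_erase {G : Type*} [DecidableEq G] (v : G → ℝ) (X Y : Finset G) (h : Bal v Y X)
    (hY : Y ≠ ∅) : ∃ g ∈ Y, ∀ c : ℝ,
      ((Y.erase g).filter (fun g => c ≤ v g)).card ≤ (X.filter (fun g => c ≤ v g)).card := by
  obtain ⟨y, hy, hym⟩ := Y.exists_max_image v (Finset.nonempty_iff_ne_empty.mpr hY)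
  refine ⟨y, hy, fun c => ?_⟩
  rw [Finset.filter_erase]
  by_cases hc : c ≤ v y
  · rw [Finset.card_erase_of_mem (by simp [hy, hc])]
    have := h c
    omega
  · have : (Y.filter (fun g => c ≤ v g)) = ∅ := by
      rw [Finset.filter_eq_empty_iff]
      intro g hg hcg
      exact hc (hcg.trans (hym g hg))
    simp [this]

/-- EF1 of one agent owning `P` towards `Q`. -/
def EE {G : Type*} (v : G → ℝ) (P Q : Finset G) : Prop :=
  Q ≠ ∅ → ∃ g ∈ Q, totalVal v Q ≤ totalVal v P + v g

theorem bal_EE {G : Type*} [DecidableEq G] (v : G → ℝ) (X Y : Finset G) (h : Bal v Y X)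
    (hX : ∀ g ∈ X, 0 ≤ v g) : EE v X Y := by
  intro hY
  obtain ⟨g, hg, hh⟩ := bal_erase v X Y h hY
  refine ⟨g, hg, ?_⟩
  have := sd_sum v _ (Y.erase g) X rfl hX hh
  unfold totalVal at *
  rw [← Finset.add_sum_erase _ _ hg]
  linarith

theorem tv_union {G : Type*} [DecidableEq G] (v : G → ℝ) {P Q : Finset G} (h : Disjoint P Q) :
    totalVal v (P ∪ Q) = totalVal v P + totalVal v Q := Finset.sum_union h

theorem EE_union {G : Type*} [DecidableEq G] (v : G → ℝ) {P Q X Y : Finset G}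
    (hPX : Disjoint P X) (hQY : Disjoint Q Y) (hQ : ∀ g ∈ Q, 0 ≤ v g) (hX : ∀ g ∈ X, 0 ≤ v g)
    (h : totalVal v Q ≤ totalVal v P) (h' : EE v X Y) : EE v (P ∪ X) (Q ∪ Y) := by
  intro hne
  rw [tv_union v hPX, tv_union v hQY]
  by_cases hY : Y = ∅
  · subst hY
    obtain ⟨g, hg⟩ := Finset.nonempty_iff_ne_empty.mpr hne
    rw [Finset.union_empty] at hg
    have hX' : 0 ≤ totalVal v X := Finset.sum_nonneg hX
    have hg' := hQ g hg
    have h0 : totalVal v (∅ : Finset G) = 0 := by simp [totalVal]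
    exact ⟨g, by simpa using hg, by linarith⟩
  · obtain ⟨g, hg, h2⟩ := h' hY
    exact ⟨g, by simp [hg], by linarith⟩

theorem EE_union' {G : Type*} [DecidableEq G] (v : G → ℝ) {P Q X Y : Finset G}
    (hPX : Disjoint P X) (hQY : Disjoint Q Y) (hY : ∀ g ∈ Y, 0 ≤ v g) (hP : ∀ g ∈ P, 0 ≤ v g)
    (h' : EE v P Q) (h : totalVal v Y ≤ totalVal v X) : EE v (P ∪ X) (Q ∪ Y) := by
  rw [Finset.union_comm P, Finset.union_comm Q]
  exact EE_union v hPX.symm hQY.symm hY hP h h'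

/-- Goods of the days before `t`. -/
def UU {G : Type*} [DecidableEq G] (M : ℕ → Finset G) (t : ℕ) : Finset G :=
  (Finset.range t).biUnion M

/-- A partial solution. -/
structure Good {G : Type*} [DecidableEq G] (v : Fin 2 → G → ℝ) (M : ℕ → Finset G) (t : ℕ)
    (A B : Finset G) : Prop where
  disj : Disjoint A B
  cover : A ∪ B = UU M t
  bal : ∀ r < t, ∀ i, Bal (v i) (A ∩ M r) (B ∩ M r) ∧ Bal (v i) (B ∩ M r) (A ∩ M r)
  ef : ∀ r ≤ t, EE (v 0) (A ∩ UU M r) (B ∩ UU M r) ∧ EE (v 1) (B ∩ UU M r) (A ∩ UU M r)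

theorem UU_succ {G : Type*} [DecidableEq G] (M : ℕ → Finset G) (t : ℕ) :
    UU M (t + 1) = UU M t ∪ M t := by
  unfold UU
  rw [Finset.range_add_one, Finset.biUnion_insert, Finset.union_comm]

theorem UU_disj {G : Type*} [DecidableEq G] (M : ℕ → Finset G)
    (hM : ∀ r s, r ≠ s → Disjoint (M r) (M s)) (r t : ℕ) (h : r ≤ t) :
    Disjoint (M t) (UU M r) := by
  unfold UU
  rw [Finset.disjoint_biUnion_right]
  intro s hs
  rw [Finset.mem_range] at hs
  exact hM _ _ (by omega)

theorem inter_add {G : Type*} [DecidableEq G] {A X U : Finset G} (h : Disjoint X U) :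
    (A ∪ X) ∩ U = A ∩ U := by
  rw [Finset.union_inter_distrib_right, Finset.disjoint_iff_inter_eq_empty.mp h,
    Finset.union_empty]

theorem inter_add' {G : Type*} [DecidableEq G] {A X U : Finset G} (h : Disjoint A U)
    (hX : X ⊆ U) : (A ∪ X) ∩ U = X := by
  rw [Finset.union_inter_distrib_right, Finset.disjoint_iff_inter_eq_empty.mp h,
    Finset.empty_union, Finset.inter_eq_left.mpr hX]

theorem Good.extend {G : Type*} [DecidableEq G] {v : Fin 2 → G → ℝ} {M : ℕ → Finset G} {t : ℕ}
    {A B X Y : Finset G} (hM : ∀ r s, r ≠ s → Disjoint (M r) (M s)) (h : Good v M t A B)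
    (hd : Disjoint X Y) (hc : X ∪ Y = M t) (hb : ∀ i, Bal (v i) X Y ∧ Bal (v i) Y X)
    (e0 : EE (v 0) (A ∪ X) (B ∪ Y)) (e1 : EE (v 1) (B ∪ Y) (A ∪ X)) :
    Good v M (t + 1) (A ∪ X) (B ∪ Y) := by
  have hX : X ⊆ M t := hc ▸ Finset.subset_union_left
  have hY : Y ⊆ M t := hc ▸ Finset.subset_union_right
  have hA : A ⊆ UU M t := h.cover ▸ Finset.subset_union_left
  have hB : B ⊆ UU M t := h.cover ▸ Finset.subset_union_right
  have hU := UU_disj M hM t t le_rfl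
  have hcov : (A ∪ X) ∪ (B ∪ Y) = UU M (t + 1) := by
    rw [UU_succ, ← h.cover, ← hc, Finset.union_union_union_comm]
  refine ⟨?_, hcov, ?_, ?_⟩
  · rw [Finset.disjoint_union_left, Finset.disjoint_union_right, Finset.disjoint_union_right]
    exact ⟨⟨h.disj, (hU.mono hY hA).symm⟩, hU.mono hX hB, hd⟩
  · intro r hr i
    rcases Nat.lt_succ_iff_lt_or_eq.mp hr with hr | rfl
    · have := hM t r (by omega)
      rw [inter_add (this.mono_left hX), inter_add (this.mono_left hY)]
      exact h.bal r hr i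
    · rw [inter_add' (hU.symm.mono_left hA) hX, inter_add' (hU.symm.mono_left hB) hY]
      exact hb i
  · intro r hr
    rcases Nat.le_succ_iff.mp hr with hr | rfl
    · have := UU_disj M hM r t hr
      rw [inter_add (this.mono_left hX), inter_add (this.mono_left hY)]
      exact h.ef r hr
    · rw [Finset.inter_eq_left.mpr (hcov ▸ Finset.subset_union_left),
        Finset.inter_eq_left.mpr (hcov ▸ Finset.subset_union_right)]
      exact ⟨e0, e1⟩

theorem Good.final {G : Type*} [DecidableEq G] {v : Fin 2 → G → ℝ} {M : ℕ → Finset G} {t : ℕ}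
    {A B : Finset G} (h : Good v M t A B) : EE (v 0) A B ∧ EE (v 1) B A := by
  have := h.ef t le_rfl
  rwa [Finset.inter_eq_left.mpr (h.cover ▸ Finset.subset_union_left),
        Finset.inter_eq_left.mpr (h.cover ▸ Finset.subset_union_right)] at this

theorem main_ind {G : Type*} [DecidableEq G] (v : Fin 2 → G → ℝ) (M : ℕ → Finset G)
    (hM : ∀ r s, r ≠ s → Disjoint (M r) (M s)) (hv : ∀ i r, ∀ g ∈ M r, 0 ≤ v i g) (t : ℕ) :
    ∃ A B A' B', Good v M t A B ∧ Good v M t A' B' ∧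
      totalVal (v 0) B ≤ totalVal (v 0) A ∧ totalVal (v 1) A' ≤ totalVal (v 1) B' ∧
      totalVal (v 0) B + totalVal (v 0) B' ≤ totalVal (v 0) A + totalVal (v 0) A' ∧
      totalVal (v 1) A + totalVal (v 1) A' ≤ totalVal (v 1) B + totalVal (v 1) B' := by
  induction t with
  | zero =>
    have hg : Good v M 0 ∅ ∅ := by
      refine ⟨by simp, by simp [UU], by simp, ?_⟩
      intro r _
      simp [EE]
    exact ⟨∅, ∅, ∅, ∅, hg, hg, le_rfl, le_rfl, le_rfl, le_rfl⟩
  | succ t ih =>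
    obtain ⟨A, B, A', B', h, h', a0, b0, sa, sb⟩ := ih
    have hvU : ∀ i, ∀ g ∈ UU M t, 0 ≤ v i g := by
      intro i g hg
      simp only [UU, Finset.mem_biUnion] at hg
      obtain ⟨r, _, hr⟩ := hg
      exact hv i r g hr
    have hU := UU_disj M hM t t le_rfl
    have nA : ∀ {A B}, Good v M t A B → A ⊆ UU M t ∧ B ⊆ UU M t := fun h =>
      ⟨h.cover ▸ Finset.subset_union_left, h.cover ▸ Finset.subset_union_right⟩
    -- a normalised split of day `t`: agent 0 weakly prefers `X`
    obtain ⟨X, Y, hd, hc, hb, hp⟩ : ∃ X Y : Finset G, Disjoint X Y ∧ X ∪ Y = M t ∧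
        (∀ i, Bal (v i) X Y ∧ Bal (v i) Y X) ∧ totalVal (v 0) Y ≤ totalVal (v 0) X := by
      obtain ⟨X, Y, hd, hc, hb⟩ := day_split v (M t)
      rcases le_total (totalVal (v 0) Y) (totalVal (v 0) X) with hp | hp
      · exact ⟨X, Y, hd, hc, hb, hp⟩
      · exact ⟨Y, X, hd.symm, by rw [Finset.union_comm, hc], fun i => (hb i).symm, hp⟩
    have hX : X ⊆ M t := hc ▸ Finset.subset_union_left
    have hY : Y ⊆ M t := hc ▸ Finset.subset_union_right
    have vX : ∀ i, ∀ g ∈ X, 0 ≤ v i g := fun i g hg => hv i t g (hX hg)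
    have vY : ∀ i, ∀ g ∈ Y, 0 ≤ v i g := fun i g hg => hv i t g (hY hg)
    have eXY : ∀ i, EE (v i) X Y := fun i => bal_EE _ _ _ (hb i).2 (vX i)
    have eYX : ∀ i, EE (v i) Y X := fun i => bal_EE _ _ _ (hb i).1 (vY i)
    have dis : ∀ {P Z : Finset G}, P ⊆ UU M t → Z ⊆ M t → Disjoint P Z :=
      fun hP hZ => (hU.mono hZ hP).symm
    have tv : ∀ {P Z : Finset G} (i : Fin 2), P ⊆ UU M t → Z ⊆ M t →
        totalVal (v i) (P ∪ Z) = totalVal (v i) P + totalVal (v i) Z :=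
      fun i hP hZ => tv_union _ (dis hP hZ)
    have nn : ∀ {P : Finset G} (i : Fin 2), P ⊆ UU M t → ∀ g ∈ P, 0 ≤ v i g :=
      fun i hP g hg => hvU i g (hP hg)
    obtain ⟨hA, hB⟩ := nA h
    obtain ⟨hA', hB'⟩ := nA h'
    rcases le_total (totalVal (v 1) X) (totalVal (v 1) Y) with hq | hq
    · -- both agents agree with `X` for agent 0, `Y` for agent 1
      have step : ∀ {A B}, Good v M t A B → Good v M (t + 1) (A ∪ X) (B ∪ Y) := by
        intro A B h
        obtain ⟨hA, hB⟩ := nA h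
        exact h.extend hM hd hc hb
          (EE_union' _ (dis hA hX) (dis hB hY) (vY 0) (nn 0 hA) h.final.1 hp)
          (EE_union' _ (dis hB hY) (dis hA hX) (vX 1) (nn 1 hB) h.final.2 hq)
      refine ⟨_, _, _, _, step h, step h', ?_, ?_, ?_, ?_⟩ <;>
        simp only [tv _ hA hX, tv _ hB hY, tv _ hA' hX, tv _ hB' hY] <;> linarith
    · -- both agents prefer `X`
      have g1 : Good v M (t + 1) (A ∪ Y) (B ∪ X) :=
        h.extend hM hd.symm (by rw [Finset.union_comm, hc]) (fun i => (hb i).symm)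
          (EE_union _ (dis hA hY) (dis hB hX) (nn 0 hB) (vY 0) a0 (eYX 0))
          (EE_union' _ (dis hB hX) (dis hA hY) (vY 1) (nn 1 hB) h.final.2 hq)
      have g2 : Good v M (t + 1) (A' ∪ X) (B' ∪ Y) :=
        h'.extend hM hd hc hb
          (EE_union' _ (dis hA' hX) (dis hB' hY) (vY 0) (nn 0 hA') h'.final.1 hp)
          (EE_union _ (dis hB' hY) (dis hA' hX) (nn 1 hA') (vY 1) b0 (eYX 1))
      have E1 := tv 0 hA hY
      have E2 := tv 0 hB hX
      have E3 := tv 1 hA hY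
      have E4 := tv 1 hB hX
      have F1 := tv 0 hA' hX
      have F2 := tv 0 hB' hY
      have F3 := tv 1 hA' hX
      have F4 := tv 1 hB' hY
      by_cases c1 : totalVal (v 0) (B ∪ X) ≤ totalVal (v 0) (A ∪ Y)
      · by_cases c2 : totalVal (v 1) (A ∪ Y) ≤ totalVal (v 1) (B ∪ X)
        · exact ⟨_, _, _, _, g1, g1, c1, c2, by linarith, by linarith⟩
        · exact ⟨_, _, _, _, g1, g2, c1, by linarith, by linarith, by linarith⟩
      · by_cases c2 : totalVal (v 1) (A ∪ Y) ≤ totalVal (v 1) (B ∪ X)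
        · exact ⟨_, _, _, _, g2, g1, by linarith, c2, by linarith, by linarith⟩
        · exact ⟨_, _, _, _, g2, g2, by linarith, by linarith, by linarith, by linarith⟩

theorem bal_SD {G : Type*} [DecidableEq G] (v : G → ℝ) (S X Y : Finset G) (hX : X ⊆ S)
    (hY : Y ⊆ S) (h : Bal v Y X) (hne : Y ≠ ∅) : ∃ g ∈ Y, SDge v S X (Y.erase g) := by
  obtain ⟨g, hg, hh⟩ := bal_erase v X Y h hne
  refine ⟨g, hg, fun z _ => ?_⟩
  have key : ∀ Z ⊆ S, Z ∩ topSet v S z = Z.filter (fun g => v z ≤ v g) := by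
    intro Z hZ
    ext a
    simp only [topSet, Finset.mem_inter, Finset.mem_filter]
    exact ⟨fun h => ⟨h.1, h.2.2⟩, fun h => ⟨h.1, hZ h.1, h.2⟩⟩
  rw [key _ hX, key _ ((Finset.erase_subset _ _).trans hY)]
  exact hh _

theorem EE_ef {G : Type*} [DecidableEq G] (v : G → ℝ) (P Q : Finset G) (h : EE v P Q)
    (hne : Q ≠ ∅) : ∃ g ∈ Q, totalVal v (Q.erase g) ≤ totalVal v P := by
  obtain ⟨g, hg, hh⟩ := h hne
  refine ⟨g, hg, ?_⟩
  unfold totalVal at *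
  rw [← Finset.add_sum_erase _ _ hg] at hh
  linarith

theorem EE_refl {G : Type*} (v : G → ℝ) (P : Finset G) (hP : ∀ g ∈ P, 0 ≤ v g) : EE v P P := by
  intro hne
  obtain ⟨g, hg⟩ := Finset.nonempty_iff_ne_empty.mpr hne
  exact ⟨g, hg, by linarith [hP g hg]⟩

/-- For every temporal fair division instance with two agents, there is
an allocation of all the goods that is SD-EF1 per day and EF1 up to each day. -/
theorem two_agents_sdef1_perDay_ef1_upToEachDay
    {G : Type*} [DecidableEq G] (k : ℕ)
    (M : Fin k → Finset G)
    (hdisj : ∀ t t' : Fin k, t ≠ t' → Disjoint (M t) (M t'))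
    (v : Fin 2 → G → ℝ)
    (hv : ∀ i : Fin 2, ∀ g ∈ Finset.univ.biUnion M, 0 ≤ v i g) :
    ∃ A : Fin 2 → Finset G,
      IsAlloc 2 (Finset.univ.biUnion M) A ∧
      (∀ t : Fin k, SDEF1 2 v (M t) (fun i => A i ∩ M t)) ∧
      (∀ t : Fin k, EF1 2 v (fun i => A i ∩ upTo M t)) := by
  obtain ⟨N, hN⟩ : ∃ N : ℕ → Finset G,
      N = fun n => if h : n < k then M ⟨n, h⟩ else ∅ := ⟨_, rfl⟩
  have hNt : ∀ t : Fin k, N t = M t := by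
    intro t; rw [hN]; simp
  have hNd : ∀ r s, r ≠ s → Disjoint (N r) (N s) := by
    intro r s hrs
    rw [hN]
    by_cases hr : r < k
    · by_cases hs : s < k
      · simp only [hr, hs, dif_pos]
        exact hdisj _ _ (by simpa using hrs)
      · simp [hs]
    · simp [hr]
  have hNv : ∀ i r, ∀ g ∈ N r, 0 ≤ v i g := by
    intro i r g hg
    by_cases hr : r < k
    · exact hv i g (Finset.mem_biUnion.mpr ⟨⟨r, hr⟩, Finset.mem_univ _, hNt ⟨r, hr⟩ ▸ hg⟩)
    · rw [hN] at hg; simp [hr] at hg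
  have hUk : UU N k = Finset.univ.biUnion M := by
    ext g
    simp only [UU, Finset.mem_biUnion, Finset.mem_range, Finset.mem_univ, true_and]
    constructor
    · rintro ⟨r, hr, hg⟩
      exact ⟨⟨r, hr⟩, hNt ⟨r, hr⟩ ▸ hg⟩
    · rintro ⟨t, hg⟩
      exact ⟨t, t.2, (hNt t).symm ▸ hg⟩
  have hUt : ∀ t : Fin k, upTo M t = UU N (t + 1) := by
    intro t
    ext g
    simp only [UU, upTo, Finset.mem_biUnion, Finset.mem_range, Finset.mem_Iic]
    constructor
    · rintro ⟨s, hs, hg⟩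
      exact ⟨s, Nat.lt_succ_of_le hs, (hNt s).symm ▸ hg⟩
    · rintro ⟨r, hr, hg⟩
      have hrk : r < k := by have := t.2; omega
      exact ⟨⟨r, hrk⟩, Nat.le_of_lt_succ hr, hNt ⟨r, hrk⟩ ▸ hg⟩
  obtain ⟨A, B, -, -, h, -⟩ := main_ind v N hNd hNv k
  have nnA : ∀ i, ∀ g ∈ A ∪ B, 0 ≤ v i g := by
    intro i g hg
    rw [h.cover, hUk] at hg
    exact hv i g hg
  refine ⟨![A, B], ⟨?_, ?_⟩, ?_, ?_⟩
  · intro i j hij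
    fin_cases i <;> fin_cases j
    · exact absurd rfl hij
    · exact h.disj
    · exact h.disj.symm
    · exact absurd rfl hij
  · rw [← hUk, ← h.cover]
    ext g
    simp [Fin.exists_fin_two]
  · intro t
    have hb := h.bal t t.2
    rw [hNt] at hb
    have self : ∀ (i : Fin 2) (P : Finset G), Bal (v i) P P := fun i P c => Nat.le_succ _
    intro i j hne
    refine bal_SD (v i) (M t) _ _ Finset.inter_subset_right Finset.inter_subset_right ?_ hne
    fin_cases i <;> fin_cases j
    · exact self _ _
    · exact (hb 0).2
    · exact (hb 1).1
    · exact self _ _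
  · intro t
    have he := h.ef (t + 1) t.2
    rw [← hUt] at he
    intro i j hne
    refine EE_ef (v i) _ _ ?_ hne
    fin_cases i <;> fin_cases j
    · exact EE_refl _ _ fun g hg =>
        nnA 0 g (Finset.mem_union_left _ (Finset.mem_of_mem_inter_left hg))
    · exact he.1
    · exact he.2
    · exact EE_refl _ _ fun g hg =>
        nnA 1 g (Finset.mem_union_right _ (Finset.mem_of_mem_inter_left hg))
end
end

section
/- For every temporal fair division instance with n = 2 agents and identical days, there exists an allocation A of M that is SD-EF1 per day, SD-EF1 up to each day, and such that A_{M̄_t} is SD-EF for every even day t ∈ [k]. -/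
open Finset
open scoped Classical

noncomputable section

/-- The allocation `A` of goods `S` is SD-EF. -/
def SDEF {G : Type*} [DecidableEq G] (n : ℕ) (v : Fin n → G → ℝ) (S : Finset G)
    (A : Fin n → Finset G) : Prop :=
  ∀ i j : Fin n, SDge (v i) S (A i) (A j)

lemma fpf_coloring {α : Type*} (σ τ : Equiv.Perm α) (hσ : ∀ x, σ (σ x) = x) (hτ : ∀ x, τ (τ x) = x)
    (hσ' : ∀ x, σ x ≠ x) (hτ' : ∀ x, τ x ≠ x) :
    ∃ c : α → Bool, (∀ x, c (σ x) = !(c x)) ∧ (∀ x, c (τ x) = !(c x)) := by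
  classical
  have hσσ : σ * σ = 1 := by ext x; simp [hσ]
  have hττ : τ * τ = 1 := by ext x; simp [hτ]
  have hσi : σ⁻¹ = σ := inv_eq_of_mul_eq_one_left hσσ
  have hτi : τ⁻¹ = τ := inv_eq_of_mul_eq_one_left hττ
  set ρ : Equiv.Perm α := σ * τ with hρ
  have hconj : σ * ρ * σ⁻¹ = ρ⁻¹ := by
    rw [hρ, mul_inv_rev, hσi, hτi, ← mul_assoc, hσσ, one_mul]
  have hconjk : ∀ k : ℤ, σ * ρ ^ k = ρ ^ (-k) * σ := by
    intro k
    have := (conj_zpow (a := σ) (b := ρ) (i := k))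
    rw [hconj] at this
    rw [zpow_neg, ← inv_zpow, this]; group
  have key : ∀ k : ℤ, ∀ x, (ρ ^ k) x ≠ σ x := by
    intro k x h
    rcases Int.even_or_odd' k with ⟨j, hj | hj⟩
    · -- apply ρ^(-j)
      apply hσ' ((ρ ^ j) x)
      have h1 : σ ((ρ ^ j) x) = (ρ ^ (-j)) (σ x) := by
        have := congrArg (fun p : Equiv.Perm α => p x) (hconjk j); simpa using this
      rw [h1, ← h, ← Equiv.Perm.mul_apply, ← zpow_add]
      congr 2; omega
    · apply hτ' ((ρ ^ j) x)
      have h1 : σ ((ρ ^ (j+1)) x) = (ρ ^ (-(j+1))) (σ x) := by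
        have := congrArg (fun p : Equiv.Perm α => p x) (hconjk (j+1)); simpa using this
      have h2 : τ ((ρ ^ j) x) = σ ((ρ ^ (j+1)) x) := by
        have : ρ ^ (j+1) = σ * τ * ρ ^ j := by rw [add_comm, zpow_add, zpow_one]
        rw [this]; simp [hσ]
      rw [h2, h1, ← h, ← Equiv.Perm.mul_apply, ← zpow_add]
      congr 2; omega
  let Q := Quotient (Equiv.Perm.SameCycle.setoid ρ)
  let q : α → Q := fun x => Quotient.mk _ x
  have hq : ∀ x y, q x = q y ↔ ∃ k : ℤ, (ρ ^ k) x = y := by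
    intro x y
    exact Quotient.eq (r := Equiv.Perm.SameCycle.setoid ρ)
  have hqs : ∀ x y, q x = q y → q (σ x) = q (σ y) := by
    intro x y h
    obtain ⟨k, rfl⟩ := (hq x y).1 h
    refine (hq _ _).2 ⟨-k, ?_⟩
    have := congrArg (fun p : Equiv.Perm α => p x) (hconjk k)
    simpa using this.symm
  have hqne : ∀ x, q x ≠ q (σ x) := by
    intro x h
    obtain ⟨k, hk⟩ := (hq _ _).1 h
    exact key k x hk
  have hqt : ∀ x, q (τ x) = q (σ x) := by
    intro x
    have h0 : q x = q (ρ x) := (hq _ _).2 ⟨1, by simp⟩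
    have := hqs _ _ h0
    rw [this]; simp [hρ, hσ]
  let _ : LinearOrder Q := IsWellOrder.linearOrder WellOrderingRel
  have hs : ∀ x, decide (q (σ x) < q (σ (σ x))) = !(decide (q x < q (σ x))) := by
    intro x
    rw [hσ]
    rcases lt_or_gt_of_ne (hqne x) with h | h
    · simp [h, h.le]
    · simp [h, h.le]
  refine ⟨fun x => decide (q x < q (σ x)), hs, ?_⟩
  intro x
  have := hs x
  have e2 : q (σ (τ x)) = q (σ (σ x)) := hqs _ _ (hqt x)
  simp only [hqt x, e2]
  exact this

def xorPerm : Equiv.Perm ℕ where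
  toFun n := if n % 2 = 0 then n + 1 else n - 1
  invFun n := if n % 2 = 0 then n + 1 else n - 1
  left_inv n := by dsimp only; split_ifs <;> omega
  right_inv n := by dsimp only; split_ifs <;> omega

lemma xorPerm_apply (n : ℕ) : xorPerm n = if n % 2 = 0 then n + 1 else n - 1 := rfl

lemma xorPerm_invol (n : ℕ) : xorPerm (xorPerm n) = n := xorPerm.left_inv n

lemma xorPerm_ne (n : ℕ) : xorPerm n ≠ n := by
  rw [xorPerm_apply]; split_ifs <;> omega

def bsgn (b : Bool) : ℤ := if b then 1 else -1

lemma prefix_sum (c : ℕ → Bool) (hc : ∀ n, c (xorPerm n) = !(c n)) (n : ℕ) :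
    |∑ i ∈ range n, bsgn (c i)| ≤ 1 := by
  have hev : ∀ j, ∑ i ∈ range (2 * j), bsgn (c i) = 0 := by
    intro j
    induction j with
    | zero => simp
    | succ j ih =>
      rw [show 2 * (j+1) = 2 * j + 1 + 1 by ring, sum_range_succ, sum_range_succ, ih]
      have := hc (2 * j)
      rw [xorPerm_apply] at this
      simp at this
      rw [this]
      cases c (2*j) <;> simp [bsgn]
  rcases Nat.even_or_odd' n with ⟨j, rfl | rfl⟩
  · rw [hev]; simp
  · rw [sum_range_succ, hev]
    cases c (2*j) <;> simp [bsgn]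

/-- Two permutations of an initial segment. -/
lemma exists_color_two (m : ℕ) (π : Equiv.Perm (Fin m)) :
    ∃ c : ℕ → Bool, ∃ c' : ℕ → Bool, (∀ n, c (xorPerm n) = !(c n)) ∧
      (∀ n, c' (xorPerm n) = !(c' n)) ∧ ∀ a : Fin m, c a = c' (π a) := by
  let p : Equiv.Perm ℕ := π.extendDomain (Fin.equivSubtype)
  have hp : ∀ a : Fin m, p a = (π a : ℕ) := fun a =>
    Equiv.Perm.extendDomain_apply_image π Fin.equivSubtype a
  obtain ⟨c, h1, h2⟩ := fpf_coloring xorPerm (p⁻¹ * xorPerm * p) xorPerm_invol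
    (by intro x; simp [xorPerm_invol]) xorPerm_ne
    (by
      intro x h
      apply xorPerm_ne (p x)
      have := congrArg p h
      simpa using this)
  refine ⟨c, fun n => c (p⁻¹ n), h1, ?_, ?_⟩
  · intro n
    have := h2 (p⁻¹ n)
    simpa using this
  · intro a
    show _ = c (p⁻¹ _)
    rw [← hp]; simp

lemma sorted_sum {G : Type*} (S : Finset G) (v : G → ℝ) (m : ℕ)
    (e : Fin m ≃ S) (he : Antitone (fun a => v (e a))) (χ : G → ℤ) (c : ℕ → Bool)
    (hc : ∀ n, c (xorPerm n) = !(c n)) (hχ : ∀ a, χ (e a) = bsgn (c a)) (r : ℝ) :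
    |∑ x ∈ S.filter (fun x => r ≤ v x), χ x| ≤ 1 := by
  let T : Finset ℕ := (univ.filter (fun a : Fin m => r ≤ v (e a))).map Fin.valEmbedding
  have hT : ∑ x ∈ S.filter (fun x => r ≤ v x), χ x = ∑ n ∈ T, bsgn (c n) := by
    rw [sum_map, sum_filter, sum_filter, ← sum_coe_sort S, ← e.sum_comp]
    apply sum_congr rfl
    intro a _
    simp [hχ]
  have hlow : ∃ n, T = range n := by
    have hmem : ∀ n, n ∈ T ↔ ∃ h : n < m, r ≤ v (e ⟨n, h⟩) := by
      intro n
      simp only [T, mem_map, mem_filter, mem_univ, true_and, Fin.valEmbedding_apply]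
      constructor
      · rintro ⟨a, ha, rfl⟩; exact ⟨a.2, ha⟩
      · rintro ⟨h, h'⟩; exact ⟨⟨n, h⟩, h', rfl⟩
    have hex : ∃ n, n ∉ T := ⟨m, by rw [hmem]; rintro ⟨h, _⟩; omega⟩
    refine ⟨Nat.find hex, ?_⟩
    ext n
    rw [mem_range]
    constructor
    · intro hn
      by_contra hlt
      apply Nat.find_spec hex
      obtain ⟨h, h'⟩ := (hmem n).1 hn
      rw [hmem]
      refine ⟨by omega, h'.trans (he ?_)⟩
      simp only [Fin.mk_le_mk]; omega
    · intro hn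
      have := Nat.find_min hex hn
      simpa using this
  obtain ⟨n, hn⟩ := hlow
  rw [hT, hn]
  exact prefix_sum c hc n

lemma exists_sorted {G : Type*} (S : Finset G) (v : G → ℝ) :
    ∃ e : Fin S.card ≃ S, Antitone (fun a => v (e a)) := by
  let e0 : Fin S.card ≃ S := S.equivFin.symm
  refine ⟨(Tuple.sort (fun a => - v (e0 a))).trans e0, ?_⟩
  intro a b hab
  have := Tuple.monotone_sort (fun a => - v (e0 a)) hab
  simpa using this

lemma day_coloring {G : Type*} (S : Finset G) (v : Fin 2 → G → ℝ) :
    ∃ χ : G → ℤ, (∀ x, χ x = 1 ∨ χ x = -1) ∧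
      ∀ i r, |∑ x ∈ S.filter (fun x => r ≤ v i x), χ x| ≤ 1 := by
  obtain ⟨e, he⟩ := exists_sorted S (v 0)
  obtain ⟨e', he'⟩ := exists_sorted S (v 1)
  obtain ⟨c, c', hc, hc', hcc⟩ := exists_color_two S.card (e.trans e'.symm)
  let χ : G → ℤ := fun x => if h : x ∈ S then bsgn (c (e.symm ⟨x, h⟩)) else 1
  refine ⟨χ, ?_, ?_⟩
  · intro x
    simp only [χ, bsgn]
    split_ifs <;> simp
  · intro i r
    fin_cases i
    · exact sorted_sum S (v 0) _ e he χ c hc (by intro a; simp [χ]) r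
    · refine sorted_sum S (v 1) _ e' he' χ c' hc' ?_ r
      intro a
      simp only [χ, coe_mem, dite_true, Subtype.coe_eta]
      rw [hcc]
      simp

lemma alloc_sum {G : Type*} [DecidableEq G] (U S H : Finset G) (hS : S ⊆ U) (hH : H ⊆ S) (χ : G → ℤ)
    (hχ : ∀ x ∈ U, χ x = 1 ∨ χ x = -1) :
    (((U.filter (fun x => χ x = 1)) ∩ S ∩ H).card : ℤ) -
      (((U.filter (fun x => ¬ χ x = 1)) ∩ S ∩ H).card : ℤ) = ∑ x ∈ H, χ x := by
  have h1 : (U.filter (fun x => χ x = 1)) ∩ S ∩ H = H.filter (fun x => χ x = 1) := by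
    ext x; simp only [mem_inter, mem_filter]
    exact ⟨fun h => ⟨h.2, h.1.1.2⟩, fun h => ⟨⟨⟨hS (hH h.1), h.2⟩, hH h.1⟩, h.1⟩⟩
  have h2 : (U.filter (fun x => ¬ χ x = 1)) ∩ S ∩ H = H.filter (fun x => ¬ χ x = 1) := by
    ext x; simp only [mem_inter, mem_filter]
    exact ⟨fun h => ⟨h.2, h.1.1.2⟩, fun h => ⟨⟨⟨hS (hH h.1), h.2⟩, hH h.1⟩, h.1⟩⟩
  rw [h1, h2, ← sum_filter_add_sum_filter_not H (fun x => χ x = 1)]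
  rw [sum_congr rfl (g := fun _ => (1:ℤ)) (fun x hx => (mem_filter.1 hx).2),
    sum_congr (s₁ := H.filter (fun x => ¬ χ x = 1)) rfl (g := fun _ => (-1:ℤ))
      (fun x hx => (hχ x (hS (hH (mem_filter.1 hx).1))).resolve_left (mem_filter.1 hx).2)]
  simp [sub_eq_add_neg]

lemma sdge_erase_of {G : Type*} [DecidableEq G] (v : G → ℝ) (S X Y : Finset G)
    (hY : Y ⊆ S) (hne : Y ≠ ∅)
    (h : ∀ g ∈ S, (Y ∩ topSet v S g).card ≤ (X ∩ topSet v S g).card + 1) :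
    ∃ g ∈ Y, SDge v S X (Y.erase g) := by
  obtain ⟨g, hg, hmax⟩ := exists_max_image Y v (nonempty_iff_ne_empty.2 hne)
  refine ⟨g, hg, ?_⟩
  intro a ha
  rw [erase_inter]
  by_cases hga : v a ≤ v g
  · have hm : g ∈ Y ∩ topSet v S a := mem_inter.2 ⟨hg, mem_filter.2 ⟨hY hg, hga⟩⟩
    rw [card_erase_of_mem hm]
    have := h a ha
    omega
  · have : Y ∩ topSet v S a = ∅ := by
      apply eq_empty_of_forall_notMem
      intro x hx
      rw [mem_inter] at hx
      exact hga ((mem_filter.1 hx.2).2.trans (hmax x hx.1))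
    rw [this]; simp

lemma sdef_of_sum {G : Type*} [DecidableEq G] (v : Fin 2 → G → ℝ) (U S : Finset G) (hS : S ⊆ U)
    (χ : G → ℤ) (hχ : ∀ x ∈ U, χ x = 1 ∨ χ x = -1)
    (A : Fin 2 → Finset G) (hA0 : A 0 = U.filter (fun x => χ x = 1))
    (hA1 : A 1 = U.filter (fun x => ¬ χ x = 1))
    (h : ∀ i r, ∑ x ∈ S.filter (fun x => r ≤ v i x), χ x = 0) :
    SDEF 2 v S (fun i => A i ∩ S) := by
  intro i j g hg
  have := alloc_sum U S (topSet (v i) S g) hS (filter_subset _ _) χ hχ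
  rw [← hA0, ← hA1] at this
  have h' := h i (v i g)
  change ∑ x ∈ topSet (v i) S g, χ x = 0 at h'
  rw [h'] at this
  revert this
  generalize topSet (v i) S g = H
  intro this
  fin_cases i <;> fin_cases j <;> simp only [Fin.zero_eta, Fin.mk_one] <;> omega

lemma sdef1_of_sum {G : Type*} [DecidableEq G] (v : Fin 2 → G → ℝ) (U S : Finset G) (hS : S ⊆ U)
    (χ : G → ℤ) (hχ : ∀ x ∈ U, χ x = 1 ∨ χ x = -1)
    (A : Fin 2 → Finset G) (hA0 : A 0 = U.filter (fun x => χ x = 1))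
    (hA1 : A 1 = U.filter (fun x => ¬ χ x = 1))
    (h : ∀ i r, |∑ x ∈ S.filter (fun x => r ≤ v i x), χ x| ≤ 1) :
    SDEF1 2 v S (fun i => A i ∩ S) := by
  intro i j hne
  apply sdge_erase_of _ _ _ _ inter_subset_right hne
  intro g hg
  have := alloc_sum U S (topSet (v i) S g) hS (filter_subset _ _) χ hχ
  rw [← hA0, ← hA1] at this
  have h' := h i (v i g)
  change |∑ x ∈ topSet (v i) S g, χ x| ≤ 1 at h'
  rw [← this, abs_le] at h'
  revert h'
  generalize topSet (v i) S g = H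
  intro h'
  fin_cases i <;> fin_cases j <;> simp only [Fin.zero_eta, Fin.mk_one] <;> omega

lemma alt_sum (n : ℕ) : ∑ s ∈ range (n + 1), (-1 : ℤ) ^ s = if Even (n + 1) then 0 else 1 := by
  induction n with
  | zero => simp
  | succ n ih =>
    rw [sum_range_succ, ih]
    rcases Nat.even_or_odd (n+1) with h | h
    · have : ¬ Even (n+1+1) := by simpa [Nat.even_add_one] using h
      simp [h, this]
    · have : Even (n+1+1) := h.add_one
      have h' : ¬ Even (n+1) := by simpa using h
      rw [if_neg h', if_pos this, h.neg_one_pow]; rfl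


/-- For every temporal fair division instance with two agents and
identical days, there is an allocation that is SD-EF1 per day, SD-EF1 up to each day, and
SD-EF up to each even day (day `t : Fin k` is the `(t+1)`-st day). -/
theorem two_agents_identical_days
    {G : Type*} [DecidableEq G] (k : ℕ)
    (M : Fin k → Finset G)
    (hdisj : ∀ t t' : Fin k, t ≠ t' → Disjoint (M t) (M t'))
    (v : Fin 2 → G → ℝ)
    (hv : ∀ i : Fin 2, ∀ g ∈ Finset.univ.biUnion M, 0 ≤ v i g)
    (hid : ∀ t t' : Fin k, ∃ f : G → G,
      Set.BijOn f ↑(M t) ↑(M t') ∧ ∀ i : Fin 2, ∀ g ∈ M t, v i g = v i (f g)) :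
    ∃ A : Fin 2 → Finset G,
      IsAlloc 2 (Finset.univ.biUnion M) A ∧
      (∀ t : Fin k, SDEF1 2 v (M t) (fun i => A i ∩ M t)) ∧
      (∀ t : Fin k, SDEF1 2 v (upTo M t) (fun i => A i ∩ upTo M t)) ∧
      (∀ t : Fin k, Even (t.val + 1) → SDEF 2 v (upTo M t) (fun i => A i ∩ upTo M t)) := by
  rcases Nat.eq_zero_or_pos k with hk | hk
  · subst hk
    refine ⟨fun _ => ∅, ⟨by simp, ?_⟩, fun t => t.elim0, fun t => t.elim0, fun t => t.elim0⟩
    ext x; simp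
  let t0 : Fin k := ⟨0, hk⟩
  obtain ⟨χ, hχ, hd⟩ := day_coloring (M t0) v
  choose f hf hfv using fun t => hid t t0
  let U := Finset.univ.biUnion M
  have hU : ∀ x, x ∈ U ↔ ∃ t, x ∈ M t := by intro x; simp [U]
  let day : G → Fin k := fun x => if h : ∃ t, x ∈ M t then h.choose else t0
  have hday : ∀ t, ∀ x ∈ M t, day x = t := by
    intro t x hx
    have h : ∃ t, x ∈ M t := ⟨t, hx⟩
    have hc := h.choose_spec
    simp only [day, dif_pos h]
    by_contra hne
    exact Finset.disjoint_left.1 (hdisj _ _ hne) hc hx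
  let ψ : G → ℤ := fun x => (-1) ^ (day x).val * χ (f (day x) x)
  have hψ : ∀ x ∈ U, ψ x = 1 ∨ ψ x = -1 := by
    intro x _
    rcases neg_one_pow_eq_or ℤ (day x).val with h | h <;>
    rcases hχ (f (day x) x) with h' | h' <;> simp [ψ, h, h']
  have hdaysum : ∀ t i r, ∑ x ∈ (M t).filter (fun x => r ≤ v i x), ψ x =
      (-1) ^ t.val * ∑ x ∈ (M t0).filter (fun x => r ≤ v i x), χ x := by
    intro t i r
    rw [Finset.mul_sum]
    refine Finset.sum_bij (fun x _ => f t x) ?_ ?_ ?_ ?_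
    · intro x hx
      rw [Finset.mem_filter] at hx ⊢
      exact ⟨(hf t).mapsTo hx.1, (hfv t i x hx.1) ▸ hx.2⟩
    · intro x hx y hy hxy
      exact (hf t).injOn (Finset.mem_filter.1 hx).1 (Finset.mem_filter.1 hy).1 hxy
    · intro y hy
      rw [Finset.mem_filter] at hy
      obtain ⟨x, hx, rfl⟩ := (hf t).surjOn hy.1
      refine ⟨x, Finset.mem_filter.2 ⟨hx, ?_⟩, rfl⟩
      rw [hfv t i x hx]; exact hy.2
    · intro x hx
      simp only [ψ]
      rw [hday t x (Finset.mem_filter.1 hx).1]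
  have hupsum : ∀ t i r, ∑ x ∈ (upTo M t).filter (fun x => r ≤ v i x), ψ x =
      (if Even (t.val + 1) then 0 else 1) * ∑ x ∈ (M t0).filter (fun x => r ≤ v i x), χ x := by
    intro t i r
    unfold upTo
    rw [Finset.filter_biUnion, Finset.sum_biUnion]
    · rw [Finset.sum_congr rfl (fun s _ => hdaysum s i r), ← Finset.sum_mul]
      congr 1
      rw [← alt_sum]
      refine Finset.sum_bij (fun s _ => s.val) ?_ ?_ ?_ ?_
      · intro s hs
        rw [Finset.mem_Iic, Fin.le_def] at hs
        rw [Finset.mem_range]; omega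
      · intro a _ b _ h; exact Fin.ext h
      · intro n hn
        rw [Finset.mem_range] at hn
        refine ⟨⟨n, by omega⟩, ?_, rfl⟩
        rw [Finset.mem_Iic, Fin.le_def]; simp only; omega
      · intro s _; rfl
    · intro a _ b _ hab
      exact Finset.disjoint_filter_filter (hdisj a b hab)
  have hMU : ∀ t, M t ⊆ U := fun t x hx => (hU x).2 ⟨t, hx⟩
  have hupU : ∀ t, upTo M t ⊆ U := by
    intro t x hx
    obtain ⟨s, _, hs⟩ := Finset.mem_biUnion.1 hx
    exact hMU s hs
  let A : Fin 2 → Finset G := ![U.filter (fun x => ψ x = 1), U.filter (fun x => ¬ ψ x = 1)]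
  have hdisjA : Disjoint (A 0) (A 1) := Finset.disjoint_filter_filter_not _ _ _
  refine ⟨A, ⟨?_, ?_⟩, ?_, ?_, ?_⟩
  · intro i j hij
    fin_cases i <;> fin_cases j
    · exact absurd rfl hij
    · exact hdisjA
    · exact hdisjA.symm
    · exact absurd rfl hij
  · ext x
    have h1 : x ∈ A 0 ↔ x ∈ U ∧ ψ x = 1 := Finset.mem_filter
    have h2 : x ∈ A 1 ↔ x ∈ U ∧ ¬ ψ x = 1 := Finset.mem_filter
    have h3 := hU x
    simp only [Finset.mem_biUnion, Finset.mem_univ, true_and, Fin.exists_fin_two]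
    rw [h1, h2, ← h3, ← and_or_left]
    exact and_iff_left (Classical.em _)
  · intro t
    refine sdef1_of_sum v U _ (hMU t) ψ hψ A rfl rfl ?_
    intro i r
    rw [hdaysum, abs_mul, abs_pow]
    simpa using hd i r
  · intro t
    refine sdef1_of_sum v U _ (hupU t) ψ hψ A rfl rfl ?_
    intro i r
    rw [hupsum]
    split_ifs
    · simp
    · simpa using hd i r
  · intro t ht
    refine sdef_of_sum v U _ (hupU t) ψ hψ A rfl rfl ?_
    intro i r
    rw [hupsum, if_pos ht, zero_mul]
end
end
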